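/- Let n > 2k ≥ 2. Then there exists a constant C = C(n,k) > 0 such that for every u ∈ C_c^∞(ℝⁿ), ‖u‖_{L^{2n/(n−2k)}(ℝⁿ)} ≤ C ‖(−Δ)^k u‖_{L^{2n/(n+2k)}(ℝⁿ)}. -/

import Mathlib

open Metric Set MeasureTheory Bornology Filter Pointwise

noncomputable section

/-- Euclidean space `ℝⁿ`. -/
abbrev Euc (n : ℕ) : Type := EuclideanSpace ℝ (Fin n)

/-- A `C^{m,θ}`-smooth bounded domain of `ℝⁿ`, described via a defining function `ρ`
of class `C^m` whose `m`-th derivative is `θ`-Hölder continuous, with nonvanishing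
gradient on the boundary. -/
def IsHolderDomain (n m : ℕ) (θ : ℝ) (Ω : Set (Euc n)) : Prop :=
  IsOpen Ω ∧ IsBounded Ω ∧ IsConnected Ω ∧
  ∃ ρ : Euc n → ℝ, ContDiff ℝ m ρ ∧
    (∃ C : ℝ, ∀ x y : Euc n,
      ‖iteratedFDeriv ℝ m ρ x - iteratedFDeriv ℝ m ρ y‖ ≤ C * ‖x - y‖ ^ θ) ∧
    Ω = {x | ρ x < 0} ∧ frontier Ω = {x | ρ x = 0} ∧
    ∀ x ∈ frontier Ω, fderiv ℝ ρ x ≠ 0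

/-- The Euclidean Laplacian `Δ f`. -/
def eucLap {n : ℕ} (f : Euc n → ℝ) (x : Euc n) : ℝ :=
  ∑ i : Fin n, iteratedFDeriv ℝ 2 f x ![EuclideanSpace.single i 1, EuclideanSpace.single i 1]

/-- The polyharmonic operator `(−Δ)^k`. -/
def polyLap {n : ℕ} (k : ℕ) (f : Euc n → ℝ) : Euc n → ℝ :=
  (fun g x => - eucLap g x)^[k] f

/-- `θ`-Hölder continuity on a set. -/
def HolderOn {n : ℕ} (θ : ℝ) (f : Euc n → ℝ) (s : Set (Euc n)) : Prop :=
  ∃ C : ℝ, ∀ x ∈ s, ∀ y ∈ s, |f x - f y| ≤ C * ‖x - y‖ ^ θ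

/-- `u ∈ C^{2k,θ}(D̄)` solves the Dirichlet problem `(−Δ)^k u = f` in `D`,
`u = ∂_ν u = … = ∂_ν^{(k−1)} u = 0` on `∂D` (the boundary conditions being encoded as the
vanishing of all derivatives of order `< k` on the boundary). -/
def IsDirichletSolution {n : ℕ} (k : ℕ) (θ : ℝ) (D : Set (Euc n)) (f u : Euc n → ℝ) : Prop :=
  ContDiffOn ℝ (2*k) u (closure D) ∧
  (∃ C : ℝ, ∀ x ∈ closure D, ∀ y ∈ closure D,
      ‖iteratedFDerivWithin ℝ (2*k) u (closure D) x -
        iteratedFDerivWithin ℝ (2*k) u (closure D) y‖ ≤ C * ‖x - y‖ ^ θ) ∧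
  (∀ x ∈ D, polyLap k u x = f x) ∧
  (∀ i : ℕ, i < k → ∀ x ∈ frontier D, iteratedFDerivWithin ℝ i u (closure D) x = 0)

/-- `G` is the Dirichlet Green function of `(−Δ)^k` on `D`: for every `f ∈ C^{0,θ}(D̄)`,
`x ↦ ∫_D G(x,y) f(y) dy` is the unique solution of the Dirichlet problem. -/
def IsGreenFunction {n : ℕ} (k : ℕ) (θ : ℝ) (D : Set (Euc n)) (G : Euc n → Euc n → ℝ) : Prop :=
  ∀ f : Euc n → ℝ, ContinuousOn f (closure D) → HolderOn θ f (closure D) →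
    IsDirichletSolution k θ D f (fun x => ∫ y in D, G x y * f y) ∧
    ∀ u : Euc n → ℝ, IsDirichletSolution k θ D f u →
      ∀ x ∈ closure D, u x = ∫ y in D, G x y * f y

/-- The inversion at the unit sphere, `inv(x) = x/|x|²`. -/
def invMap {n : ℕ} (x : Euc n) : Euc n := (‖x‖ ^ 2)⁻¹ • x

/-- `ω₀ := inv(ℝⁿ ∖ ω̄) ∪ {0}`. -/
def omegaZero {n : ℕ} (ω : Set (Euc n)) : Set (Euc n) :=
  (invMap '' (closure ω)ᶜ) ∪ {0}

/-- The exterior Green function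
`G_{(εω)^c}(x,y) := ε^{n−2k} |x|^{2k−n} |y|^{2k−n} G₀(ε·inv(x), ε·inv(y))`,
where `G₀` is the Dirichlet Green function of `(−Δ)^k` on `ω₀`. -/
def extGreen {n : ℕ} (k : ℕ) (G₀ : Euc n → Euc n → ℝ) (ε : ℝ) (x y : Euc n) : ℝ :=
  ε ^ ((n : ℝ) - 2*k) * ‖x‖ ^ (2*(k:ℝ) - n) * ‖y‖ ^ (2*(k:ℝ) - n) *
    G₀ (ε • invMap x) (ε • invMap y)

/-- The partial derivative `∂ᵢ f`. -/
def eucPartial {n : ℕ} (i : Fin n) (f : Euc n → ℝ) (x : Euc n) : ℝ :=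
  fderiv ℝ f x (EuclideanSpace.single i 1)

/-- Membership in `C_c^∞(ℝⁿ)`. -/
def IsTestFunction {n : ℕ} (u : Euc n → ℝ) : Prop :=
  ContDiff ℝ (⊤ : ℕ∞) u ∧ HasCompactSupport u

namespace IsTestFunction

variable {n : ℕ} {u v : Euc n → ℝ}

lemma differentiable (hu : IsTestFunction u) : Differentiable ℝ u :=
  hu.1.differentiable (by simp)

lemma memLp (hu : IsTestFunction u) (p : ENNReal) : MemLp u p :=
  hu.1.continuous.memLp_of_hasCompactSupport hu.2

lemma integrable_mul (hu : IsTestFunction u) (hv : IsTestFunction v) :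
    Integrable (fun x => u x * v x) :=
  (hu.1.continuous.mul hv.1.continuous).integrable_of_hasCompactSupport hu.2.mul_right

lemma eucPartial (hu : IsTestFunction u) (i : Fin n) : IsTestFunction (eucPartial i u) :=
  ⟨(hu.1.fderiv_right (by simp)).clm_apply contDiff_const, hu.2.fderiv_apply ℝ _⟩

lemma neg (hu : IsTestFunction u) : IsTestFunction (fun x => - u x) :=
  ⟨hu.1.neg, hu.2.neg⟩

lemma sum {ι : Type*} {f : ι → Euc n → ℝ} (s : Finset ι) (hf : ∀ i, IsTestFunction (f i)) :
    IsTestFunction (fun x => ∑ i ∈ s, f i x) := by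
  classical
  induction s using Finset.induction_on with
  | empty =>
    simp only [Finset.sum_empty]
    exact ⟨contDiff_const, HasCompactSupport.zero⟩
  | insert a s ha ih =>
    simp only [Finset.sum_insert ha]
    exact ⟨(hf a).1.add ih.1, (hf a).2.add ih.2⟩

end IsTestFunction

section PolyLap

variable {n : ℕ} {u v : Euc n → ℝ}

lemma eucPartial_eucPartial_apply (hu : IsTestFunction u) (i j : Fin n) (x : Euc n) :
    eucPartial i (eucPartial j u) x =
      fderiv ℝ (fderiv ℝ u) x (EuclideanSpace.single i 1) (EuclideanSpace.single j 1) := by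
  have h : DifferentiableAt ℝ (fderiv ℝ u) x :=
    ((hu.1.fderiv_right (m := 1) (by norm_cast)).differentiable (by simp)) x
  unfold eucPartial
  rw [fderiv_clm_apply h (differentiableAt_const _)]
  simp

lemma eucPartial_comm (hu : IsTestFunction u) (i j : Fin n) :
    eucPartial i (eucPartial j u) = eucPartial j (eucPartial i u) := by
  ext x
  rw [eucPartial_eucPartial_apply hu, eucPartial_eucPartial_apply hu]
  exact (hu.1.contDiffAt.isSymmSndFDerivAt (by simp; norm_cast)).eq _ _

lemma eucLap_eq_sum (hu : IsTestFunction u) (x : Euc n) :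
    eucLap u x = ∑ i, eucPartial i (eucPartial i u) x := by
  simp [eucLap, iteratedFDeriv_two_apply, eucPartial_eucPartial_apply hu]

lemma IsTestFunction.neg_eucLap (hu : IsTestFunction u) :
    IsTestFunction (fun x => - eucLap u x) := by
  simp only [eucLap_eq_sum hu]
  exact (IsTestFunction.sum _ fun i => (hu.eucPartial i).eucPartial i).neg

lemma eucPartial_neg_eucLap (hu : IsTestFunction u) (i : Fin n) :
    eucPartial i (fun x => - eucLap u x) = fun x => - eucLap (eucPartial i u) x := by
  ext x
  have h (j : Fin n) := ((hu.eucPartial j).eucPartial j).differentiable x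
  simp only [eucLap_eq_sum hu, eucLap_eq_sum (hu.eucPartial i)]
  change fderiv ℝ (fun y => - ∑ j, eucPartial j (eucPartial j u) y) x _ = _
  rw [fderiv_fun_neg, fderiv_fun_sum fun j _ => h j]
  simp only [_root_.neg_apply, _root_.sum_apply]
  congr 1
  refine Finset.sum_congr rfl fun j _ => ?_
  change eucPartial i (eucPartial j (eucPartial j u)) x = _
  rw [eucPartial_comm (hu.eucPartial j), eucPartial_comm hu]

lemma polyLap_succ (k : ℕ) (u : Euc n → ℝ) :
    polyLap (k + 1) u = fun x => - eucLap (polyLap k u) x :=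
  Function.iterate_succ_apply' _ _ _

lemma IsTestFunction.polyLap (hu : IsTestFunction u) (k : ℕ) : IsTestFunction (polyLap k u) := by
  induction k with
  | zero => exact hu
  | succ k ih => rw [polyLap_succ]; exact ih.neg_eucLap

lemma eucPartial_polyLap (hu : IsTestFunction u) (k : ℕ) (i : Fin n) :
    eucPartial i (polyLap k u) = polyLap k (eucPartial i u) := by
  induction k with
  | zero => rfl
  | succ k ih => rw [polyLap_succ, polyLap_succ, eucPartial_neg_eucLap (hu.polyLap k), ih]

lemma integral_mul_eucPartial (hu : IsTestFunction u) (hv : IsTestFunction v) (i : Fin n) :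
    ∫ x, u x * eucPartial i v x = - ∫ x, eucPartial i u x * v x :=
  integral_mul_fderiv_eq_neg_fderiv_mul_of_integrable ((hu.eucPartial i).integrable_mul hv)
    (hu.integrable_mul (hv.eucPartial i)) (hu.integrable_mul hv)
    (fun _ _ => hu.differentiable _) (fun _ _ => hv.differentiable _)

/-- Integrating by parts once splits the energy `∫ u (−Δ)^{k+1} u` over the partial derivatives. -/
lemma integral_mul_polyLap_succ (hu : IsTestFunction u) (k : ℕ) :
    ∫ x, u x * polyLap (k + 1) u x =
      ∑ i, ∫ x, eucPartial i u x * polyLap k (eucPartial i u) x := by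
  have hv := hu.polyLap k
  calc ∫ x, u x * polyLap (k + 1) u x
      = ∫ x, - ∑ i, u x * eucPartial i (eucPartial i (polyLap k u)) x := by
        simp only [polyLap_succ, eucLap_eq_sum hv, mul_neg, Finset.mul_sum]
    _ = ∑ i, - ∫ x, u x * eucPartial i (eucPartial i (polyLap k u)) x := by
        rw [integral_neg, integral_finsetSum _ fun i _ =>
          hu.integrable_mul ((hv.eucPartial i).eucPartial i), Finset.sum_neg_distrib]
    _ = _ := by
        refine Finset.sum_congr rfl fun i _ => ?_
        rw [integral_mul_eucPartial hu (hv.eucPartial i), neg_neg, eucPartial_polyLap hu]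

lemma norm_fderiv_le_sum_eucPartial (u : Euc n → ℝ) (x : Euc n) :
    ‖fderiv ℝ u x‖ ≤ ∑ i, ‖eucPartial i u x‖ := by
  refine ContinuousLinearMap.opNorm_le_bound _ (by positivity) fun y => ?_
  have hy : y = ∑ i, y i • EuclideanSpace.single i (1 : ℝ) := by
    simpa using ((EuclideanSpace.basisFun (Fin n) ℝ).sum_repr y).symm
  calc ‖fderiv ℝ u x y‖ = ‖∑ i, y i * eucPartial i u x‖ := by
        conv_lhs => rw [hy]
        simp [eucPartial]
    _ ≤ ∑ i, ‖y i * eucPartial i u x‖ := norm_sum_le _ _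
    _ ≤ (∑ i, ‖eucPartial i u x‖) * ‖y‖ := by
        rw [Finset.sum_mul]
        gcongr with i
        rw [norm_mul, mul_comm]
        gcongr
        exact PiLp.norm_apply_le y i

lemma eLpNorm_fderiv_le_sum_eucPartial (hu : IsTestFunction u) {p : ENNReal} (hp : 1 ≤ p) :
    eLpNorm (fderiv ℝ u) p volume ≤ ∑ i, eLpNorm (eucPartial i u) p volume := by
  calc eLpNorm (fderiv ℝ u) p volume
      ≤ eLpNorm (∑ i, fun x => ‖eucPartial i u x‖) p volume := by
        refine eLpNorm_mono_real fun x => ?_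
        simpa using norm_fderiv_le_sum_eucPartial u x
    _ ≤ ∑ i, eLpNorm (fun x => ‖eucPartial i u x‖) p volume :=
        eLpNorm_sum_le (fun i _ => ((hu.eucPartial i).memLp p).1.norm) hp
    _ = _ := by simp only [eLpNorm_norm]

lemma IsTestFunction.toReal_eLpNorm (hu : IsTestFunction u) {p : NNReal} (hp : p ≠ 0) :
    (eLpNorm u p volume).toReal = (∫ x, |u x| ^ (p : ℝ)) ^ (p : ℝ)⁻¹ := by
  rw [(hu.memLp p).eLpNorm_eq_integral_rpow_norm (by simpa) (by simp),
    ENNReal.toReal_ofReal (by positivity)]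
  simp

/-- The `L²`-based Sobolev inequality of order `k`, with the homogeneous Sobolev norm written as
the energy `∫ u (−Δ)^k u`. -/
lemma exists_sq_eLpNorm_le_integral_mul_polyLap (k : ℕ) (hn : 2 * k < n) (p : NNReal)
    (hp : (p : ℝ)⁻¹ = 1 / 2 - k / n) :
    ∃ C > (0 : ℝ), ∀ u : Euc n → ℝ, IsTestFunction u →
      (eLpNorm u p volume).toReal ^ 2 ≤ C * ∫ x, u x * polyLap k u x := by
  induction k generalizing p with
  | zero =>
    refine ⟨1, one_pos, fun u hu => le_of_eq ?_⟩
    obtain rfl : p = 2 := by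
      have : (p : ℝ) = 2 := by rw [← inv_inv (p : ℝ), hp]; norm_num
      exact_mod_cast this
    have h0 : 0 ≤ ∫ x, |u x| ^ (2 : ℝ) := integral_nonneg fun x => by positivity
    rw [hu.toReal_eLpNorm two_ne_zero, one_mul]
    simp only [NNReal.coe_ofNat]
    rw [← Real.rpow_natCast, ← Real.rpow_mul h0]
    norm_num [polyLap, pow_two]
  | succ k ih =>
    have hn0 : (0 : ℝ) < n := by exact_mod_cast (by omega : 0 < n)
    have hkn : 2 * ((k : ℝ) + 1) < n := by exact_mod_cast hn
    have hpos : (0 : ℝ) < 1 / 2 - k / n := by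
      rw [sub_pos, div_lt_div_iff₀ hn0 two_pos]; linarith
    let q : NNReal := ⟨(1 / 2 - (k : ℝ) / n)⁻¹, by positivity⟩
    have hq : (q : ℝ)⁻¹ = 1 / 2 - k / n := inv_inv _
    have hq1 : 1 ≤ q := by
      have : (1 : ℝ) ≤ (1 / 2 - (k : ℝ) / n)⁻¹ := by
        rw [one_le_inv₀ hpos]
        have : (0 : ℝ) ≤ (k : ℝ) / n := by positivity
        linarith
      exact this
    obtain ⟨C, hC, h⟩ := ih (by omega) q hq
    let K : NNReal := SNormLESNormFDerivOfEqConst ℝ (volume : Measure (Euc n)) q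
    refine ⟨((K : ℝ) ^ 2 + 1) * (n * C), by positivity, fun u hu => ?_⟩
    have hGNS : eLpNorm u p volume ≤ K * ∑ i, eLpNorm (eucPartial i u) q volume := by
      refine (eLpNorm_le_eLpNorm_fderiv_of_eq volume (hu.1.of_le (by norm_cast)) hu.2 hq1
        (by simp; omega) ?_).trans ?_
      · rw [NNReal.coe_inv, hp, hq, finrank_euclideanSpace_fin]
        push_cast
        ring
      · gcongr
        exact eLpNorm_fderiv_le_sum_eucPartial hu (by exact_mod_cast hq1)
    have hfin (i : Fin n) : eLpNorm (eucPartial i u) q volume ≠ ⊤ :=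
      ((hu.eucPartial i).memLp q).eLpNorm_ne_top
    have hreal : (eLpNorm u p volume).toReal ≤
        K * ∑ i, (eLpNorm (eucPartial i u) q volume).toReal := by
      have := ENNReal.toReal_mono
        (ENNReal.mul_ne_top ENNReal.coe_ne_top (by simpa using hfin)) hGNS
      rwa [ENNReal.toReal_mul, ENNReal.coe_toReal, ENNReal.toReal_sum fun i _ => hfin i] at this
    have hsum : (∑ i, (eLpNorm (eucPartial i u) q volume).toReal) ^ 2 ≤
        n * C * ∫ x, u x * polyLap (k + 1) u x := by
      calc (∑ i, (eLpNorm (eucPartial i u) q volume).toReal) ^ 2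
          ≤ n * ∑ i, (eLpNorm (eucPartial i u) q volume).toReal ^ 2 := by
            simpa using sq_sum_le_card_mul_sum_sq (s := Finset.univ)
              (f := fun i => (eLpNorm (eucPartial i u) q volume).toReal)
        _ ≤ n * ∑ i, C * ∫ x, eucPartial i u x * polyLap k (eucPartial i u) x := by
            gcongr with i
            exact h _ (hu.eucPartial i)
        _ = _ := by rw [integral_mul_polyLap_succ hu, ← Finset.mul_sum, mul_assoc]
    calc (eLpNorm u p volume).toReal ^ 2
        ≤ (K * ∑ i, (eLpNorm (eucPartial i u) q volume).toReal) ^ 2 := by gcongr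
      _ ≤ ((K : ℝ) ^ 2 + 1) * (∑ i, (eLpNorm (eucPartial i u) q volume).toReal) ^ 2 := by
          rw [mul_pow]
          gcongr
          linarith
      _ ≤ ((K : ℝ) ^ 2 + 1) * (n * C * ∫ x, u x * polyLap (k + 1) u x) := by gcongr
      _ = _ := by ring

end PolyLap

/-- Sobolev-type inequality `‖u‖_{2n/(n−2k)} ≤ C ‖(−Δ)^k u‖_{2n/(n+2k)}` on `ℝⁿ`. -/
theorem sobolev_inequality_polyLap
    (n k : ℕ) (hk : 1 ≤ k) (hn : 2*k < n) :
    ∃ C > (0:ℝ), ∀ u : Euc n → ℝ, ContDiff ℝ (⊤ : ℕ∞) u → HasCompactSupport u →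
      (∫ x, |u x| ^ (2*(n:ℝ)/((n:ℝ) - 2*k))) ^ (((n:ℝ) - 2*k)/(2*(n:ℝ))) ≤
        C * (∫ x, |polyLap k u x| ^ (2*(n:ℝ)/((n:ℝ) + 2*k))) ^ (((n:ℝ) + 2*k)/(2*(n:ℝ))) := by
  have hn0 : (0 : ℝ) < n := by exact_mod_cast (by omega : 0 < n)
  have hkn : 2 * (k : ℝ) < n := by exact_mod_cast hn
  have hsub : (0 : ℝ) < n - 2 * k := by linarith
  have hadd : (0 : ℝ) < n + 2 * k := by positivity
  let q : NNReal := ⟨2 * n / (n - 2 * k), by positivity⟩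
  have hq : (q : ℝ) = 2 * n / (n - 2 * k) := rfl
  have hq0 : q ≠ 0 := by
    have : (0 : ℝ) < q := by rw [hq]; positivity
    exact_mod_cast this.ne'
  obtain ⟨C, hC, h⟩ := exists_sq_eLpNorm_le_integral_mul_polyLap k hn q (by rw [hq]; field_simp)
  refine ⟨C, hC, fun u hu hsupp => ?_⟩
  have htest : IsTestFunction u := ⟨hu, hsupp⟩
  have hconj : (2 * (n : ℝ) / (n - 2 * k)).HolderConjugate (2 * n / (n + 2 * k)) := by
    rw [Real.holderConjugate_iff]
    refine ⟨by rw [lt_div_iff₀ hsub]; nlinarith [k.cast_nonneg (α := ℝ)], ?_⟩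
    field_simp
    ring
  have hholder := integral_mul_norm_le_Lp_mul_Lq hconj (htest.memLp _) ((htest.polyLap k).memLp _)
  have hsob := h u htest
  rw [htest.toReal_eLpNorm hq0, hq] at hsob
  simp only [Real.norm_eq_abs, one_div, inv_div] at hholder hsob
  set A := (∫ x, |u x| ^ (2 * (n : ℝ) / (n - 2 * k))) ^ (((n : ℝ) - 2 * k) / (2 * n))
  set B := (∫ x, |polyLap k u x| ^ (2 * (n : ℝ) / (n + 2 * k))) ^ (((n : ℝ) + 2 * k) / (2 * n))
  have hA : 0 ≤ A := Real.rpow_nonneg (integral_nonneg fun x => by positivity) _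
  have hB : 0 ≤ B := Real.rpow_nonneg (integral_nonneg fun x => by positivity) _
  have henergy : ∫ x, u x * polyLap k u x ≤ A * B := by
    refine le_trans ?_ hholder
    simp only [← abs_mul]
    exact (le_abs_self _).trans abs_integral_le_integral_abs
  rcases hA.eq_or_lt with hA0 | hA0
  · rw [← hA0]; positivity
  · refine le_of_mul_le_mul_left ?_ hA0
    calc A * A = A ^ 2 := (sq A).symm
      _ ≤ C * ∫ x, u x * polyLap k u x := hsob
      _ ≤ C * (A * B) := by gcongr
      _ = A * (C * B) := by ring
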